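/- arXiv:1501.04361 — 4 statements merged into one kernel-verified Lean document; each statement's English description precedes it below -/
import Mathlib

section
/- Ishii's lemma: let v and ṽ be two continuous functions on an open subset 𝒪 ⊆ ℝ^d, let n > 0, and suppose the function Δ(x,y) := v(x) − ṽ(y) − (n/2)|x − y|² attains a local maximum at (x̂, ŷ) ∈ 𝒪 × 𝒪. Then there exist symmetric d×d matrices X and Y such that (n(x̂ − ŷ), X) ∈ J̄⁺v(x̂), (n(x̂ − ŷ), Y) ∈ J̄⁻ṽ(ŷ), and for all u, w ∈ ℝ^d, ⟨Xu, u⟩ − ⟨Yw, w⟩ ≤ 3n |u − w|². -/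
open Set Filter Topology RealInnerProductSpace

noncomputable section

abbrev Euc (d : ℕ) := EuclideanSpace ℝ (Fin d)

/-- The quadratic form `⟨Xh, h⟩ = Σ_{i,j} X^{ij} h^i h^j` of a matrix. -/
def quadForm {d : ℕ} (X : Matrix (Fin d) (Fin d) ℝ) (h : Euc d) : ℝ :=
  ∑ i, ∑ j, X i j * h i * h j

/-- `Q_{p,X}(h) = p·h + ½⟨Xh, h⟩`. -/
def Qpx {d : ℕ} (p : Euc d) (X : Matrix (Fin d) (Fin d) ℝ) (h : Euc d) : ℝ :=
  ⟪p, h⟫ + (1/2) * quadForm X h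

/-- `(p,X) ∈ J⁺v(x)` relative to `O`: `v(x+h) ≤ v(x) + Q_{p,X}(h) + o(|h|²)`. -/
def MemSuperjet {d : ℕ} (O : Set (Euc d)) (v : Euc d → ℝ) (x p : Euc d)
    (X : Matrix (Fin d) (Fin d) ℝ) : Prop :=
  ∀ ε > (0:ℝ), ∃ δ > (0:ℝ), ∀ h : Euc d, ‖h‖ < δ → x + h ∈ O →
    v (x + h) ≤ v x + Qpx p X h + ε * ‖h‖ ^ 2

/-- `(p,X) ∈ J⁻v(x)` relative to `O`: `v(x+h) ≥ v(x) + Q_{p,X}(h) + o(|h|²)`. -/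
def MemSubjet {d : ℕ} (O : Set (Euc d)) (v : Euc d → ℝ) (x p : Euc d)
    (X : Matrix (Fin d) (Fin d) ℝ) : Prop :=
  ∀ ε > (0:ℝ), ∃ δ > (0:ℝ), ∀ h : Euc d, ‖h‖ < δ → x + h ∈ O →
    v x + Qpx p X h - ε * ‖h‖ ^ 2 ≤ v (x + h)

/-- `(p,X) ∈ J̄⁺v(x)`: limit of superjet elements `(p_k, X_k) ∈ J⁺v(x_k)` with `x_k → x`,
`v(x_k) → v(x)`, `p_k → p`, `X_k → X`. -/
def MemClosureSuperjet {d : ℕ} (O : Set (Euc d)) (v : Euc d → ℝ) (x p : Euc d)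
    (X : Matrix (Fin d) (Fin d) ℝ) : Prop :=
  ∃ (xs ps : ℕ → Euc d) (Xs : ℕ → Matrix (Fin d) (Fin d) ℝ),
    (∀ k, xs k ∈ O ∧ MemSuperjet O v (xs k) (ps k) (Xs k)) ∧
    Tendsto xs atTop (𝓝 x) ∧ Tendsto (fun k => v (xs k)) atTop (𝓝 (v x)) ∧
    Tendsto ps atTop (𝓝 p) ∧ Tendsto Xs atTop (𝓝 X)

/-- `(p,X) ∈ J̄⁻v(x)`: closure of the subjet, defined analogously. -/
def MemClosureSubjet {d : ℕ} (O : Set (Euc d)) (v : Euc d → ℝ) (x p : Euc d)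
    (X : Matrix (Fin d) (Fin d) ℝ) : Prop :=
  ∃ (xs ps : ℕ → Euc d) (Xs : ℕ → Matrix (Fin d) (Fin d) ℝ),
    (∀ k, xs k ∈ O ∧ MemSubjet O v (xs k) (ps k) (Xs k)) ∧
    Tendsto xs atTop (𝓝 x) ∧ Tendsto (fun k => v (xs k)) atTop (𝓝 (v x)) ∧
    Tendsto ps atTop (𝓝 p) ∧ Tendsto Xs atTop (𝓝 X)

set_option linter.unusedSectionVars false

section Abs
variable {E : Type*} [NormedAddCommGroup E] [InnerProductSpace ℝ E]

/-- `q` is a (global) subgradient of `g` at `x`. -/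
def SubG (g : E → ℝ) (x q : E) : Prop := ∀ y, g x + ⟪q, y - x⟫ ≤ g y

/-- sup-convolution -/
lemma exists_supconv (C : Set E) (hC : IsCompact C) (hne : C.Nonempty) (u : E → ℝ)
    (hu : ContinuousOn u C) (l : ℝ) :
    ∃ (xi : E → E) (f : E → ℝ), (∀ x, xi x ∈ C) ∧
      (∀ x, f x = u (xi x) - l / 2 * ‖xi x - x‖ ^ 2) ∧
      (∀ x, ∀ z ∈ C, u z - l / 2 * ‖z - x‖ ^ 2 ≤ f x) := by
  have : ∀ x : E, ∃ z ∈ C, ∀ y ∈ C, u y - l / 2 * ‖y - x‖ ^ 2 ≤ u z - l / 2 * ‖z - x‖ ^ 2 := by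
    intro x
    have hc : ContinuousOn (fun y => u y - l / 2 * ‖y - x‖ ^ 2) C := by
      apply hu.sub
      fun_prop
    obtain ⟨z, hz, h⟩ := hC.exists_isMaxOn hne hc
    exact ⟨z, hz, fun y hy => h hy⟩
  choose xi h1 h2 using this
  exact ⟨xi, fun x => u (xi x) - l / 2 * ‖xi x - x‖ ^ 2, h1, fun x => rfl, h2⟩

lemma supconv_subG (C : Set E) (u : E → ℝ) (l : ℝ) (xi : E → E) (f : E → ℝ)
    (h1 : ∀ x, xi x ∈ C)
    (h2 : ∀ x, f x = u (xi x) - l / 2 * ‖xi x - x‖ ^ 2)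
    (h3 : ∀ x, ∀ z ∈ C, u z - l / 2 * ‖z - x‖ ^ 2 ≤ f x) (x : E) :
    SubG (fun x => f x + l / 2 * ‖x‖ ^ 2) x (l • xi x) := by
  intro y
  have a := h3 y (xi x) (h1 x)
  have b := h2 x
  simp only [norm_sub_sq_real, inner_smul_left, inner_sub_right] at *
  simp
  nlinarith

lemma SubG.mono {g : E → ℝ} {x q y p : E} (h : SubG g x q) (h' : SubG g y p) :
    0 ≤ ⟪q - p, x - y⟫ := by
  have a := h y
  have b := h' x
  simp only [inner_sub_right, inner_sub_left] at *
  linarith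

/-- nonexpansiveness of the resolvent -/
lemma SubG.nonexp {g : E → ℝ} {x q y p : E} (h : SubG g x q) (h' : SubG g y p) :
    ‖x - y‖ ≤ ‖(x + q) - (y + p)‖ := by
  have a := h.mono h'
  have e : (x + q) - (y + p) = (x - y) + (q - p) := by abel
  rw [e]
  have b : ‖x - y‖ ^ 2 ≤ ‖(x - y) + (q - p)‖ ^ 2 := by
    rw [norm_add_sq_real, real_inner_comm]
    nlinarith [sq_nonneg ‖q - p‖]
  exact (sq_le_sq₀ (norm_nonneg _) (norm_nonneg _)).1 b

lemma subG_continuous (g : E → ℝ) (s : E → E) (hs : ∀ x, SubG g x (s x)) (M : ℝ)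
    (hM : ∀ x, ‖s x‖ ≤ M) : (∀ x y, g x - g y ≤ M * ‖x - y‖) ∧ Continuous g := by
  have hM0 : 0 ≤ M := (norm_nonneg _).trans (hM 0)
  have lip : ∀ x y, g x - g y ≤ M * ‖x - y‖ := by
    intro x y
    have a := hs x y
    have b := abs_real_inner_le_norm (s x) (y - x)
    have c := mul_le_mul_of_nonneg_right (hM x) (norm_nonneg (y - x))
    have := neg_abs_le ⟪s x, y - x⟫
    rw [norm_sub_rev x y]
    linarith
  refine ⟨lip, ?_⟩
  have : LipschitzWith (Real.toNNReal M) g := by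
    apply LipschitzWith.of_dist_le_mul
    intro x y
    rw [Real.dist_eq, dist_eq_norm, Real.coe_toNNReal _ hM0, abs_le]
    have := lip x y
    have := lip y x
    rw [norm_sub_rev y x] at this
    constructor <;> linarith
  exact this.continuous

lemma exists_resolvent [FiniteDimensional ℝ E] (g : E → ℝ) (s : E → E) (hs : ∀ x, SubG g x (s x)) (M : ℝ)
    (hM : ∀ x, ‖s x‖ ≤ M) : ∃ J : E → E, ∀ z, SubG g (J z) (z - J z) := by
  obtain ⟨lip, hg⟩ := subG_continuous g s hs M hM
  have key : ∀ z : E, ∃ x, ∀ y, g x + 1 / 2 * ‖x - z‖ ^ 2 ≤ g y + 1 / 2 * ‖y - z‖ ^ 2 := by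
    intro z
    have hc : Continuous (fun y => g y + 1 / 2 * ‖y - z‖ ^ 2) := by fun_prop
    have := hc.exists_forall_le_of_isBounded (x₀ := z) ?_
    · exact this
    · apply (Metric.isBounded_closedBall (x := z) (r := 2 * M)).subset
      intro y hy
      simp only [mem_ofPred_eq, sub_self, norm_zero] at hy
      rw [Metric.mem_closedBall, dist_eq_norm]
      have := lip z y
      rw [norm_sub_rev] at this
      by_contra! hh
      have hM0 : 0 ≤ M := (norm_nonneg _).trans (hM 0)
      nlinarith [norm_nonneg (y - z)]
  choose J hJ using key
  refine ⟨J, fun z y => ?_⟩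
  set x := J z with hx
  have h : ∀ t : ℝ, 0 < t → t ≤ 1 → g x + ⟪z - x, y - x⟫ ≤ g y + t / 2 * ‖y - x‖ ^ 2 := by
    intro t ht ht1
    have a := hJ z (x + t • (y - x))
    rw [← hx] at a
    set m := x + t • (y - x) with hm
    have b1 := hs m y
    have b2 := hs m x
    have e1 : y - m = (1 - t) • (y - x) := by rw [hm]; module
    have e2 : x - m = (-t) • (y - x) := by rw [hm]; module
    have e3 : m - z = t • (y - x) - (z - x) := by rw [hm]; module
    rw [e1, inner_smul_right] at b1
    rw [e2, inner_smul_right] at b2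
    rw [e3, norm_sub_sq_real (t • (y - x)), norm_smul, inner_smul_left, norm_sub_rev x z] at a
    have conv : g m ≤ (1 - t) * g x + t * g y := by nlinarith
    simp only [Real.norm_eq_abs, mul_pow, sq_abs, conj_trivial] at a
    rw [real_inner_comm (z - x)] at a
    have : t * (g x + ⟪z - x, y - x⟫) ≤ t * (g y + t / 2 * ‖y - x‖ ^ 2) := by nlinarith
    exact le_of_mul_le_mul_left this ht
  by_contra! hlt
  set G := g x + ⟪z - x, y - x⟫ - g y with hG
  have hGp : 0 < G := by linarith
  have hN : 0 < ‖y - x‖ ^ 2 + 1 := by positivity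
  have := h (min 1 (G / (‖y - x‖ ^ 2 + 1))) (by positivity) (min_le_left _ _)
  have h3 : min 1 (G / (‖y - x‖ ^ 2 + 1)) * (‖y - x‖ ^ 2 + 1) ≤ G := by
    calc _ ≤ (G / (‖y - x‖ ^ 2 + 1)) * (‖y - x‖ ^ 2 + 1) := by gcongr; exact min_le_right _ _
      _ = G := by field_simp
  have h4 : 0 < min 1 (G / (‖y - x‖ ^ 2 + 1)) := by positivity
  nlinarith

/-- Upper contact by a paraboloid. -/
def UpC (g : E → ℝ) (x q : E) (m : ℝ) : Prop := ∀ h, g (x + h) ≤ g x + ⟪q, h⟫ + m / 2 * ‖h‖ ^ 2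

lemma UpC.eq {g : E → ℝ} {x q p : E} {m : ℝ} (hm : 0 < m) (h : UpC g x q m) (h' : SubG g x p) :
    p = q := by
  have a := h ((1 / m) • (p - q))
  have b := h' (x + (1 / m) • (p - q))
  simp only [add_sub_cancel_left, inner_smul_right, norm_smul, mul_pow, Real.norm_eq_abs, sq_abs] at a b
  have c : (1 / m) * ⟪p - q, p - q⟫ ≤ m / 2 * ((1 / m) ^ 2 * ‖p - q‖ ^ 2) := by
    rw [inner_sub_left (x := p)]; linarith
  rw [real_inner_self_eq_norm_sq] at c
  field_simp at c
  have : ‖p - q‖ ^ 2 = 0 := by nlinarith [sq_nonneg ‖p - q‖]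
  simpa [sub_eq_zero] using this

lemma UpC.lip {g : E → ℝ} {x0 q0 x q : E} {m : ℝ} (hm : 0 < m) (h : UpC g x0 q0 m)
    (h0 : SubG g x0 q0) (h' : SubG g x q) : ‖q - q0‖ ≤ 2 * m * ‖x - x0‖ := by
  set k := x - x0 with hk
  set D := q - q0 with hD
  have a := h (k + (1 / (2 * m)) • D)
  have b := h' (x0 + (k + (1 / (2 * m)) • D))
  have c := h0 x
  have e : x0 + (k + (1 / (2 * m)) • D) - x = (1 / (2 * m)) • D := by rw [hk]; module
  rw [e] at b
  rw [← hk] at c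
  have tri : ‖k + (1 / (2 * m)) • D‖ ≤ ‖k‖ + (1 / (2 * m)) * ‖D‖ := by
    refine (norm_add_le _ _).trans ?_
    rw [norm_smul, Real.norm_of_nonneg (by positivity)]
  have tri2 : ‖k + (1 / (2 * m)) • D‖ ^ 2 ≤ 2 * ‖k‖ ^ 2 + 2 * ((1 / (2 * m)) * ‖D‖) ^ 2 := by
    have : ‖k + (1 / (2 * m)) • D‖ ^ 2 ≤ (‖k‖ + (1 / (2 * m)) * ‖D‖) ^ 2 := by gcongr
    nlinarith [sq_nonneg (‖k‖ - (1 / (2 * m)) * ‖D‖)]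
  have f : (1 / (2 * m)) * ⟪D, D⟫ ≤ m / 2 * ‖k + (1 / (2 * m)) • D‖ ^ 2 := by
    rw [inner_smul_right] at b
    rw [inner_add_right, inner_smul_right] at a
    nth_rewrite 1 [hD]
    rw [inner_sub_left]
    linarith
  rw [real_inner_self_eq_norm_sq] at f
  have f2 : (1 / (2 * m)) * ‖D‖ ^ 2 ≤ m / 2 * (2 * ‖k‖ ^ 2 + 2 * ((1 / (2 * m)) * ‖D‖) ^ 2) :=
    f.trans (by gcongr)
  have f3 : ‖D‖ ^ 2 ≤ (2 * m * ‖k‖) ^ 2 := by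
    field_simp at f2
    nlinarith
  exact (sq_le_sq₀ (norm_nonneg _) (by positivity)).1 f3

lemma subgrad_diff [FiniteDimensional ℝ E] {g : E → ℝ} {x0 q0 : E} {m : ℝ} (hm : 0 < m)
    (h : UpC g x0 q0 m) (h0 : SubG g x0 q0) (J : E → E) (hJ : ∀ z, SubG g (J z) (z - J z))
    (hd : DifferentiableAt ℝ J (x0 + q0)) :
    ∃ B : E →L[ℝ] E, ∀ ε > 0, ∃ δ > 0, ∀ x q, SubG g x q → ‖x - x0‖ < δ →
      ‖q - q0 - B (x - x0)‖ ≤ ε * ‖x - x0‖ := by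
  have hJe : ∀ x q, SubG g x q → J (x + q) = x := by
    intro x q hx
    have := (hJ (x + q)).nonexp hx
    simp only [add_sub_cancel, sub_self, norm_zero] at this
    have := norm_le_zero_iff.1 this
    exact sub_eq_zero.1 this
  have hlow : ∀ w, ‖w - (x0 + q0)‖ ≤ (1 + 2 * m) * ‖J w - x0‖ := by
    intro w
    have a := h.lip hm h0 (hJ w)
    have e : w - (x0 + q0) = (J w - x0) + (w - J w - q0) := by abel
    rw [e]
    refine (norm_add_le _ _).trans ?_
    linarith
  obtain ⟨D, hD⟩ := hd
  have hD' : ∀ ε > 0, ∃ δ > 0, ∀ w, ‖w - (x0 + q0)‖ < δ →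
      ‖J w - x0 - D (w - (x0 + q0))‖ ≤ ε * ‖w - (x0 + q0)‖ := by
    intro ε hε
    have := hD.isLittleO.def hε
    rw [Metric.eventually_nhds_iff] at this
    obtain ⟨δ, hδ, H⟩ := this
    refine ⟨δ, hδ, fun w hw => ?_⟩
    have := H (by rwa [dist_eq_norm])
    rwa [hJe x0 q0 h0] at this
  have hinj : Function.Injective D := by
    rw [injective_iff_map_eq_zero]
    intro a ha
    by_contra hne
    have hna : 0 < ‖a‖ := norm_pos_iff.2 hne
    obtain ⟨δ, hδ, H⟩ := hD' (1 / (2 * (1 + 2 * m))) (by positivity)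
    set t := δ / (2 * ‖a‖) with ht
    have htp : 0 < t := by positivity
    have e : (x0 + q0 + t • a) - (x0 + q0) = t • a := by abel
    have := H (x0 + q0 + t • a) (by
      rw [e, norm_smul, Real.norm_of_nonneg htp.le, ht]; field_simp; linarith)
    have h2 := hlow (x0 + q0 + t • a)
    rw [e] at this h2
    rw [map_smul, ha, smul_zero, sub_zero] at this
    have hp : 0 < ‖t • a‖ := by rw [norm_smul, Real.norm_of_nonneg htp.le]; positivity
    have h3 : ‖t • a‖ ≤ (1 + 2 * m) * (1 / (2 * (1 + 2 * m)) * ‖t • a‖) :=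
      h2.trans (by gcongr)
    field_simp at h3
    linarith
  have hsurj : Function.Surjective D := LinearMap.injective_iff_surjective.1 hinj
  let e : E ≃ₗ[ℝ] E := LinearEquiv.ofBijective D.toLinearMap ⟨hinj, hsurj⟩
  let L : E →L[ℝ] E := LinearMap.toContinuousLinearMap e.symm.toLinearMap
  have hL : ∀ a, L (D a) = a := fun a => e.symm_apply_apply a
  refine ⟨L - ContinuousLinearMap.id ℝ E, fun ε hε => ?_⟩
  obtain ⟨δ, hδ, H⟩ := hD' (ε / ((‖L‖ + 1) * (1 + 2 * m))) (by positivity)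
  refine ⟨δ / (1 + 2 * m), by positivity, fun x q hx hd => ?_⟩
  have a := hlow (x + q)
  rw [hJe x q hx] at a
  have b : ‖(x + q) - (x0 + q0)‖ < δ := a.trans_lt (by
    rw [lt_div_iff₀ (by positivity)] at hd; linarith)
  have c := H _ b
  rw [hJe x q hx] at c
  have e1 : q - q0 - (L - ContinuousLinearMap.id ℝ E) (x - x0)
      = - L (x - x0 - D (x + q - (x0 + q0))) := by
    rw [map_sub L, hL]
    simp only [sub_apply, ContinuousLinearMap.id_apply]
    abel
  rw [e1, norm_neg]
  calc _ ≤ ‖L‖ * ‖x - x0 - D (x + q - (x0 + q0))‖ := L.le_opNorm _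
    _ ≤ (‖L‖ + 1) * (ε / ((‖L‖ + 1) * (1 + 2 * m)) * ((1 + 2 * m) * ‖x - x0‖)) := by
        gcongr
        · linarith
        · exact c.trans (by gcongr)
    _ = ε * ‖x - x0‖ := by field_simp

/-- second order expansion from differentiability of the subgradient -/
lemma expansion {g : E → ℝ} {x0 q0 : E} (s : E → E)
    (hs : ∀ x, SubG g x (s x)) (B : E →L[ℝ] E)
    (hB : ∀ ε > 0, ∃ δ > 0, ∀ x q, SubG g x q → ‖x - x0‖ < δ →
      ‖q - q0 - B (x - x0)‖ ≤ ε * ‖x - x0‖) :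
    ∀ ε > 0, ∃ δ > 0, ∀ h, ‖h‖ < δ →
      |g (x0 + h) - g x0 - ⟪q0, h⟫ - 1 / 2 * ⟪B h, h⟫| ≤ ε * ‖h‖ ^ 2 := by
  intro ε hε
  obtain ⟨δ, hδ, H⟩ := hB ε hε
  refine ⟨δ, hδ, fun h hh => ?_⟩
  set b := ⟪B h, h⟫ with hb
  -- inner estimate
  have est : ∀ t : ℝ, 0 ≤ t → t ≤ 1 →
      |⟪s (x0 + t • h), h⟫ - ⟪q0, h⟫ - t * b| ≤ ε * ‖h‖ ^ 2 := by
    intro t ht ht1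
    have e : x0 + t • h - x0 = t • h := by abel
    have := H (x0 + t • h) _ (hs _) (by
      rw [e, norm_smul, Real.norm_of_nonneg ht]; nlinarith [norm_nonneg h])
    rw [e, map_smul, norm_smul, Real.norm_of_nonneg ht] at this
    have e2 : ⟪s (x0 + t • h), h⟫ - ⟪q0, h⟫ - t * b = ⟪s (x0 + t • h) - q0 - t • B h, h⟫ := by
      rw [inner_sub_left, inner_sub_left, inner_smul_left, hb]; simp
    rw [e2]
    refine (abs_real_inner_le_norm _ _).trans ?_
    calc _ ≤ ε * (t * ‖h‖) * ‖h‖ := by gcongr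
      _ ≤ ε * (1 * ‖h‖) * ‖h‖ := by gcongr
      _ = _ := by ring
  have step : ∀ m : ℕ, 0 < m → |g (x0 + h) - g x0 - ⟪q0, h⟫ - 1 / 2 * b| ≤ ε * ‖h‖ ^ 2 + |b| / (2 * m) := by
    intro m hm
    have hm' : (0:ℝ) < m := by exact_mod_cast hm
    have ind : ∀ i : ℕ, i ≤ m →
        g (x0 + ((i:ℝ) / m) • h) - g x0 - (i / m) * ⟪q0, h⟫ - (i * (i + 1)) / (2 * m ^ 2) * b
          ≤ (i / m) * (ε * ‖h‖ ^ 2) ∧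
        - ((i / m) * (ε * ‖h‖ ^ 2)) ≤
        g (x0 + ((i:ℝ) / m) • h) - g x0 - (i / m) * ⟪q0, h⟫ - (i * (i - 1)) / (2 * m ^ 2) * b := by
      intro i
      induction i with
      | zero => intro _; simp
      | succ i ih =>
        intro hi
        obtain ⟨i1, i2⟩ := ih (by omega)
        have hi' : ((i:ℝ) + 1) ≤ m := by exact_mod_cast hi
        have u1 := hs (x0 + (((i + 1 : ℕ):ℝ) / m) • h) (x0 + ((i:ℝ) / m) • h)
        have u2 := hs (x0 + ((i:ℝ) / m) • h) (x0 + (((i + 1 : ℕ):ℝ) / m) • h)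
        have e1 : x0 + ((i:ℝ) / m) • h - (x0 + (((i + 1 : ℕ):ℝ) / m) • h) = (-(1 / m : ℝ)) • h := by
          push_cast; rw [add_div]; module
        have e2 : x0 + (((i + 1 : ℕ):ℝ) / m) • h - (x0 + ((i:ℝ) / m) • h) = ((1 / m : ℝ)) • h := by
          push_cast; rw [add_div]; module
        rw [e1, inner_smul_right] at u1
        rw [e2, inner_smul_right] at u2
        have v1 := est (((i + 1 : ℕ):ℝ) / m) (by positivity) (by
          rw [div_le_one hm']; exact_mod_cast hi)
        have v2 := est ((i:ℝ) / m) (by positivity) (by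
          rw [div_le_one hm']; linarith)
        rw [abs_le] at v1 v2
        have w1 := mul_le_mul_of_nonneg_left v1.2 (by positivity : (0:ℝ) ≤ 1 / m)
        have w2 := mul_le_mul_of_nonneg_left v2.1 (by positivity : (0:ℝ) ≤ 1 / m)
        set G := g (x0 + (((i + 1 : ℕ):ℝ) / m) • h)
        set S1 := ⟪s (x0 + (((i + 1 : ℕ):ℝ) / m) • h), h⟫
        push_cast at *
        constructor
        · have : ((i:ℝ) + 1) * (i + 1 + 1) / (2 * m ^ 2) = i * (i + 1) / (2 * m ^ 2) + 1 / m * ((i + 1) / m) := by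
            field_simp; ring
          rw [this, add_div]
          rw [add_div] at w1
          nlinarith
        · have : ((i:ℝ) + 1) * (i + 1 - 1) / (2 * m ^ 2) = i * (i - 1) / (2 * m ^ 2) + 1 / m * (i / m) := by
            field_simp; ring
          rw [this, add_div]
          nlinarith
    obtain ⟨i1, i2⟩ := ind m le_rfl
    rw [div_self hm'.ne', one_smul] at i1 i2
    have e1 : (m * ((m:ℝ) + 1)) / (2 * m ^ 2) * b = 1 / 2 * b + b / (2 * m) := by field_simp
    have e2 : (m * ((m:ℝ) - 1)) / (2 * m ^ 2) * b = 1 / 2 * b - b / (2 * m) := by field_simp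
    rw [e1] at i1
    rw [e2] at i2
    have a1 : b / (2 * m) ≤ |b| / (2 * m) := by gcongr; exact le_abs_self b
    have a2 : -(b / (2 * m)) ≤ |b| / (2 * m) := by
      rw [← neg_div]; gcongr; exact neg_le_abs b
    rw [abs_le]
    constructor <;> linarith
  have lim : Tendsto (fun m : ℕ => ε * ‖h‖ ^ 2 + |b| / (2 * (m:ℝ))) atTop (𝓝 (ε * ‖h‖ ^ 2 + 0)) := by
    apply Tendsto.const_add
    have : (fun m : ℕ => |b| / (2 * (m:ℝ))) = fun m : ℕ => (|b| / 2) / (m:ℝ) := by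
      funext m; rw [div_div]
    rw [this]
    exact tendsto_const_div_atTop_nhds_zero_nat _
  rw [add_zero] at lim
  exact ge_of_tendsto lim ((eventually_gt_atTop 0).mono step)

end Abs

section Abs2
variable {E : Type*} [NormedAddCommGroup E] [InnerProductSpace ℝ E]

lemma exists_good {V : Type*} [NormedAddCommGroup V] [NormedSpace ℝ V] [FiniteDimensional ℝ V]
    (J F : V → V) (K1 K2 : NNReal) (hJ : LipschitzWith K1 J) (hF : LipschitzWith K2 F)
    (δ : ℝ) (hδ : 0 < δ) : ∃ p, ‖p‖ < δ ∧ ∀ z, F z = p → DifferentiableAt ℝ J z := by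
  borelize V
  let μ : MeasureTheory.Measure V := MeasureTheory.Measure.hausdorffMeasure (Module.finrank ℝ V)
  have hN : μ {z | ¬ DifferentiableAt ℝ J z} = 0 := hJ.ae_differentiableAt (μ := μ)
  have hI : μ (F '' {z | ¬ DifferentiableAt ℝ J z}) = 0 := by
    have := hF.hausdorffMeasure_image_le (d := (Module.finrank ℝ V : ℝ)) (by positivity)
      {z | ¬ DifferentiableAt ℝ J z}
    refine le_antisymm (this.trans ?_) (by simp)
    change _ * μ _ ≤ 0
    rw [hN, mul_zero]
  have hB : 0 < μ (Metric.ball 0 δ) := Metric.measure_ball_pos μ 0 hδ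
  by_contra! hcon
  have : Metric.ball (0 : V) δ ⊆ F '' {z | ¬ DifferentiableAt ℝ J z} := by
    intro p hp
    obtain ⟨z, hz, hz'⟩ := hcon p (by simpa using hp)
    exact ⟨z, hz', hz⟩
  exact absurd (MeasureTheory.measure_mono_null this hI) hB.ne'

lemma le_zero_of_eps {c K : ℝ} (hK : 0 ≤ K) (h : ∀ ε > 0, c ≤ ε * K) : c ≤ 0 := by
  by_contra! hc
  have := h (c / (2 * (K + 1))) (by positivity)
  rw [div_mul_eq_mul_div, le_div_iff₀ (by positivity)] at this
  nlinarith

lemma exists_small {E : Type*} [NormedAddCommGroup E] [NormedSpace ℝ E] (u : E) (δ : ℝ) (hδ : 0 < δ) : ∃ t : ℝ, 0 < t ∧ ‖t • u‖ < δ := by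
  refine ⟨δ / (‖u‖ + 1), by positivity, ?_⟩
  rw [norm_smul, Real.norm_of_nonneg (by positivity), div_mul_eq_mul_div, div_lt_iff₀ (by positivity)]
  nlinarith

lemma side [FiniteDimensional ℝ E] (C : Set E) (u : E → ℝ) (l : ℝ) (hl : 0 < l) (xi : E → E) (f : E → ℝ)
    (h1 : ∀ x, xi x ∈ C)
    (h2 : ∀ x, f x = u (xi x) - l / 2 * ‖xi x - x‖ ^ 2)
    (h3 : ∀ x, ∀ z ∈ C, u z - l / 2 * ‖z - x‖ ^ 2 ≤ f x)
    (J : E → E) (hJ : ∀ z, SubG (fun x => f x + l / 2 * ‖x‖ ^ 2) (J z) (z - J z))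
    (x P : E) (m : ℝ) (hm : 0 < m)
    (hc : ∀ h, f (x + h) ≤ f x + ⟪P, h⟫ + m / 2 * ‖h‖ ^ 2) :
    l • xi x = P + l • x ∧ J (x + (P + l • x)) = x ∧
    (DifferentiableAt ℝ J (x + (P + l • x)) → ∃ B : E →L[ℝ] E,
      (∀ ε > 0, ∃ δ > 0, ∀ h, ‖h‖ < δ →
        |f (x + h) - f x - ⟪P, h⟫ - 1 / 2 * ⟪B h, h⟫| ≤ ε * ‖h‖ ^ 2) ∧
      (∀ w, - l * ‖w‖ ^ 2 ≤ ⟪B w, w⟫) ∧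
      (∀ ε > 0, ∃ δ > 0, ∀ h, ‖h‖ < δ → xi x + h ∈ C →
        u (xi x + h) ≤ u (xi x) + ⟪P, h⟫ + 1 / 2 * ⟪B h, h⟫ + ε * ‖h‖ ^ 2)) := by
  set g : E → ℝ := fun x => f x + l / 2 * ‖x‖ ^ 2 with hg
  have hs : ∀ x, SubG g x (l • xi x) := supconv_subG C u l xi f h1 h2 h3
  have hml : 0 < m + l := by positivity
  have hup : UpC g x (P + l • x) (m + l) := by
    intro h
    have := hc h
    simp only [hg, norm_add_sq_real, inner_add_left, inner_smul_left, conj_trivial]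
    nlinarith
  have heq : l • xi x = P + l • x := hup.eq hml (hs x)
  have h0 : SubG g x (P + l • x) := heq ▸ hs x
  refine ⟨heq, ?_, fun hd => ?_⟩
  · have := (hJ (x + (P + l • x))).nonexp h0
    simp only [add_sub_cancel, sub_self, norm_zero] at this
    exact sub_eq_zero.1 (norm_le_zero_iff.1 this)
  obtain ⟨B, hB⟩ := subgrad_diff hml hup h0 J hJ hd
  have hex := expansion (fun x => l • xi x) hs B hB
  have hexf : ∀ ε > 0, ∃ δ > 0, ∀ h, ‖h‖ < δ →
        |f (x + h) - f x - ⟪P, h⟫ - 1 / 2 * ⟪(B - l • ContinuousLinearMap.id ℝ E) h, h⟫| ≤ ε * ‖h‖ ^ 2 := by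
    intro ε hε
    obtain ⟨δ, hδ, H⟩ := hex ε hε
    refine ⟨δ, hδ, fun h hh => ?_⟩
    have := H h hh
    convert this using 2
    simp only [hg, norm_add_sq_real, inner_add_left, inner_smul_left, conj_trivial, sub_apply,
      smul_apply, ContinuousLinearMap.id_apply, inner_sub_left, real_inner_self_eq_norm_sq]
    ring
  refine ⟨B - l • ContinuousLinearMap.id ℝ E, hexf, ?_, ?_⟩
  · intro w
    have : -⟪B w, w⟫ ≤ 0 := by
      refine le_zero_of_eps (K := 2 * ‖w‖ ^ 2) (by positivity) (fun ε hε => ?_)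
      obtain ⟨δ, hδ, H⟩ := hex ε hε
      obtain ⟨t, ht, ht'⟩ := exists_small w δ hδ
      have a := (abs_le.1 (H _ ht')).2
      have b := h0 (x + t • w)
      rw [add_sub_cancel_left] at b
      rw [map_smul, inner_smul_left (B w), inner_smul_right (B w), norm_smul, mul_pow, Real.norm_eq_abs, sq_abs] at a
      simp only [conj_trivial] at a
      have : t ^ 2 * (-⟪B w, w⟫) ≤ t ^ 2 * (ε * (2 * ‖w‖ ^ 2)) := by nlinarith
      exact le_of_mul_le_mul_left this (by positivity)
    simp only [sub_apply, smul_apply, ContinuousLinearMap.id_apply, inner_sub_left, inner_smul_left,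
      conj_trivial, real_inner_self_eq_norm_sq]
    linarith
  · intro ε hε
    obtain ⟨δ, hδ, H⟩ := hexf ε hε
    refine ⟨δ, hδ, fun h hh hC => ?_⟩
    have a := (abs_le.1 (H _ hh)).2
    have b := h3 (x + h) _ hC
    have c := h2 x
    rw [add_sub_add_right_eq_sub] at b
    linarith

lemma small_est {a b σ p1 p2 : ℝ} (ha : 0 ≤ a) (hb : 0 ≤ b) (hσ : 0 < σ)
    (h1 : p1 ≤ σ ^ 2) (h2 : p2 ≤ σ ^ 2)
    (h : σ * (a ^ 2 + b ^ 2) ≤ p1 * a + p2 * b) : a ≤ 2 * σ ∧ b ≤ 2 * σ := by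
  have h' : σ * (a ^ 2 + b ^ 2) ≤ σ * (σ * (a + b)) := by nlinarith
  have h'' := le_of_mul_le_mul_left h' hσ
  constructor
  · nlinarith [sq_nonneg (b - σ / 2)]
  · nlinarith [sq_nonneg (a - σ / 2)]

lemma main_step [FiniteDimensional ℝ E] (n : ℝ) (hn : 0 < n) (C : Set E) (hC : IsCompact C)
    (h0C : (0 : E) ∈ C) (u1 u2 : E → ℝ) (hu1 : ContinuousOn u1 C) (hu2 : ContinuousOn u2 C)
    (h10 : u1 0 = 0) (h20 : u2 0 = 0)
    (hmax : ∀ ξ ∈ C, ∀ η ∈ C, u1 ξ + u2 η ≤ n / 2 * ‖ξ - η‖ ^ 2)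
    (σ : ℝ) (hσ : 0 < σ) (hσ1 : σ ≤ 1) :
    ∃ ξ1 ∈ C, ∃ ξ2 ∈ C, ∃ (P1 P2 : E) (B1 B2 : E →L[ℝ] E),
      ‖ξ1‖ ≤ (2 + (5 + 12 * n) / (3 * n)) * σ ∧ ‖ξ2‖ ≤ (2 + (5 + 12 * n) / (3 * n)) * σ ∧
      ‖P1‖ ≤ (5 + 12 * n) * σ ∧ ‖P2‖ ≤ (5 + 12 * n) * σ ∧
      (∀ ε > 0, ∃ δ > 0, ∀ h, ‖h‖ < δ → ξ1 + h ∈ C →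
        u1 (ξ1 + h) ≤ u1 ξ1 + ⟪P1, h⟫ + 1 / 2 * ⟪B1 h, h⟫ + ε * ‖h‖ ^ 2) ∧
      (∀ ε > 0, ∃ δ > 0, ∀ h, ‖h‖ < δ → ξ2 + h ∈ C →
        u2 (ξ2 + h) ≤ u2 ξ2 + ⟪P2, h⟫ + 1 / 2 * ⟪B2 h, h⟫ + ε * ‖h‖ ^ 2) ∧
      (∀ w, - (3 * n) * ‖w‖ ^ 2 ≤ ⟪B1 w, w⟫) ∧ (∀ w, - (3 * n) * ‖w‖ ^ 2 ≤ ⟪B2 w, w⟫) ∧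
      (∀ v w, ⟪B1 v, v⟫ + ⟪B2 w, w⟫ ≤ 3 * n * ‖v - w‖ ^ 2 + 2 * σ * (‖v‖ ^ 2 + ‖w‖ ^ 2)) := by
  set l := 3 * n with hl
  have hlp : 0 < l := by positivity
  obtain ⟨xi1, f1, a1, b1, c1⟩ := exists_supconv C hC ⟨0, h0C⟩ u1 hu1 l
  obtain ⟨xi2, f2, a2, b2, c2⟩ := exists_supconv C hC ⟨0, h0C⟩ u2 hu2 l
  obtain ⟨M, hM⟩ := hC.isBounded.exists_norm_le
  have s1 := supconv_subG C u1 l xi1 f1 a1 b1 c1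
  have s2 := supconv_subG C u2 l xi2 f2 a2 b2 c2
  have m1 : ∀ x, ‖l • xi1 x‖ ≤ l * M := fun x => by
    rw [norm_smul, Real.norm_of_nonneg hlp.le]
    exact mul_le_mul_of_nonneg_left (hM _ (a1 x)) hlp.le
  have m2 : ∀ x, ‖l • xi2 x‖ ≤ l * M := fun x => by
    rw [norm_smul, Real.norm_of_nonneg hlp.le]
    exact mul_le_mul_of_nonneg_left (hM _ (a2 x)) hlp.le
  obtain ⟨J1, hJ1⟩ := exists_resolvent _ _ s1 _ m1
  obtain ⟨J2, hJ2⟩ := exists_resolvent _ _ s2 _ m2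
  have k1 := (subG_continuous _ _ s1 _ m1).2
  have k2 := (subG_continuous _ _ s2 _ m2).2
  have fc1 : Continuous f1 := by
    have : f1 = fun x => (f1 x + l / 2 * ‖x‖ ^ 2) - l / 2 * ‖x‖ ^ 2 := by funext x; ring
    rw [this]; exact k1.sub (by fun_prop)
  have fc2 : Continuous f2 := by
    have : f2 = fun x => (f2 x + l / 2 * ‖x‖ ^ 2) - l / 2 * ‖x‖ ^ 2 := by funext x; ring
    rw [this]; exact k2.sub (by fun_prop)
  clear k1 k2
  have lJ1 : LipschitzWith 1 J1 := by
    apply LipschitzWith.of_dist_le_mul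
    intro x y
    have := (hJ1 x).nonexp (hJ1 y)
    simpa [dist_eq_norm] using this
  have lJ2 : LipschitzWith 1 J2 := by
    apply LipschitzWith.of_dist_le_mul
    intro x y
    have := (hJ2 x).nonexp (hJ2 y)
    simpa [dist_eq_norm] using this
  -- upper bound
  have hub : ∀ x y, f1 x + f2 y ≤ l / 2 * ‖x - y‖ ^ 2 := by
    intro x y
    rw [b1, b2]
    have h := hmax _ (a1 x) _ (a2 y)
    set A := x - y
    set B := xi1 x - x
    set D := xi2 y - y
    have e : xi1 x - xi2 y = A + B - D := by simp only [A, B, D]; abel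
    rw [e] at h
    have t : ‖A + B - D‖ ≤ ‖A‖ + ‖B‖ + ‖D‖ := (norm_sub_le _ _).trans (by gcongr; exact norm_add_le _ _)
    have t2 : ‖A + B - D‖ ^ 2 ≤ 3 * (‖A‖ ^ 2 + ‖B‖ ^ 2 + ‖D‖ ^ 2) := by
      have : ‖A + B - D‖ ^ 2 ≤ (‖A‖ + ‖B‖ + ‖D‖) ^ 2 := by gcongr
      nlinarith [sq_nonneg (‖A‖ - ‖B‖), sq_nonneg (‖A‖ - ‖D‖), sq_nonneg (‖B‖ - ‖D‖)]
    have t3 := mul_le_mul_of_nonneg_left t2 (by positivity : 0 ≤ n / 2)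
    rw [hl]
    linarith
  have hlb : 0 ≤ f1 0 + f2 0 := by
    have := c1 0 0 h0C
    have := c2 0 0 h0C
    simp_all
    linarith
  -- the Lipschitz maps
  let Jm : E × E → E × E := fun z => (J1 z.1, J2 z.2)
  let F : E × E → E × E := fun z =>
    (z.1 - J1 z.1 - l • J1 z.1 - l • (J1 z.1 - J2 z.2) - (2 * σ) • J1 z.1,
     z.2 - J2 z.2 - l • J2 z.2 + l • (J1 z.1 - J2 z.2) - (2 * σ) • J2 z.2)
  have q1 : LipschitzWith 1 (fun z : E × E => J1 z.1) := by
    have := lJ1.comp (LipschitzWith.prod_fst (α := E) (β := E))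
    rw [mul_one] at this
    exact this
  have q2 : LipschitzWith 1 (fun z : E × E => J2 z.2) := by
    have := lJ2.comp (LipschitzWith.prod_snd (α := E) (β := E))
    rw [mul_one] at this
    exact this
  have smulL : ∀ (c : ℝ) (k : NNReal) (G : E × E → E), LipschitzWith k G →
      LipschitzWith (‖c‖₊ * k) (fun z => c • G z) := fun c k G hG =>
    (lipschitzWith_smul c).comp hG
  have LJ : ∃ K, LipschitzWith K Jm := ⟨_, q1.prodMk q2⟩
  have LF : ∃ K, LipschitzWith K F := ⟨_, LipschitzWith.prodMk
    ((((LipschitzWith.prod_fst.sub q1).sub (smulL l _ _ q1)).sub (smulL l _ _ (q1.sub q2))).sub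
      (smulL (2 * σ) _ _ q1))
    ((((LipschitzWith.prod_snd.sub q2).sub (smulL l _ _ q2)).add (smulL l _ _ (q1.sub q2))).sub
      (smulL (2 * σ) _ _ q2))⟩
  obtain ⟨K1, LJ⟩ := LJ
  obtain ⟨K2, LF⟩ := LF
  obtain ⟨p, hp, hdiff⟩ := exists_good Jm F K1 K2 LJ LF (σ ^ 2) (by positivity)
  have hp1 : ‖p.1‖ ≤ σ ^ 2 := (norm_fst_le p).trans hp.le
  have hp2 : ‖p.2‖ ≤ σ ^ 2 := (norm_snd_le p).trans hp.le
  -- maximum point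
  let Φ : E × E → ℝ := fun q => -(f1 q.1 + f2 q.2 - l / 2 * ‖q.1 - q.2‖ ^ 2
    - σ * (‖q.1‖ ^ 2 + ‖q.2‖ ^ 2) - ⟪p.1, q.1⟫ - ⟪p.2, q.2⟫)
  have hΦc : Continuous Φ := by
    have := fc1.comp (continuous_fst (X := E) (Y := E))
    have := fc2.comp (continuous_snd (X := E) (Y := E))
    simp only [Φ]
    fun_prop
  have hΦ : ∀ q, Φ q ≤ Φ 0 → ‖q.1‖ ≤ 2 * σ ∧ ‖q.2‖ ≤ 2 * σ := by
    intro q hq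
    refine small_est (norm_nonneg _) (norm_nonneg _) hσ hp1 hp2 ?_
    have i1 := neg_abs_le ⟪p.1, q.1⟫
    have i2 := neg_abs_le ⟪p.2, q.2⟫
    have i3 := abs_real_inner_le_norm p.1 q.1
    have i4 := abs_real_inner_le_norm p.2 q.2
    have := hub q.1 q.2
    simp [Φ] at hq
    linarith
  obtain ⟨⟨x1, x2⟩, hx⟩ := hΦc.exists_forall_le_of_isBounded 0 (by
    apply (Metric.isBounded_closedBall (x := (0 : E × E)) (r := 2 * σ)).subset
    intro q hq
    rw [mem_closedBall_zero_iff, Prod.norm_def]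
    obtain ⟨i, j⟩ := hΦ q hq
    exact max_le i j)
  obtain ⟨hx1, hx2⟩ := hΦ _ (hx 0)
  simp only at hx1 hx2
  set P1 := p.1 + l • (x1 - x2) + (2 * σ) • x1 with hP1
  set P2 := p.2 - l • (x1 - x2) + (2 * σ) • x2 with hP2
  have contact : ∀ h k, f1 (x1 + h) + f2 (x2 + k) ≤ f1 x1 + f2 x2 + ⟪P1, h⟫ + ⟪P2, k⟫
      + l / 2 * ‖h - k‖ ^ 2 + σ * (‖h‖ ^ 2 + ‖k‖ ^ 2) := by
    intro h k
    have := hx (x1 + h, x2 + k)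
    have e : x1 + h - (x2 + k) = (x1 - x2) + (h - k) := by abel
    simp only [Φ, e] at this
    rw [norm_add_sq_real (x1 - x2), norm_add_sq_real x1, norm_add_sq_real x2] at this
    simp only [hP1, hP2, inner_add_left, inner_add_right, inner_sub_left, inner_sub_right,
      inner_smul_left, conj_trivial] at this ⊢
    nlinarith
  have ct1 : ∀ h, f1 (x1 + h) ≤ f1 x1 + ⟪P1, h⟫ + (l + 2 * σ) / 2 * ‖h‖ ^ 2 := by
    intro h
    have := contact h 0
    simp at this
    linarith
  have ct2 : ∀ h, f2 (x2 + h) ≤ f2 x2 + ⟪P2, h⟫ + (l + 2 * σ) / 2 * ‖h‖ ^ 2 := by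
    intro h
    have := contact 0 h
    simp at this
    linarith
  obtain ⟨y1, z1, w1⟩ := side C u1 l hlp xi1 f1 a1 b1 c1 J1 hJ1 x1 P1 _ (by positivity) ct1
  obtain ⟨y2, z2, w2⟩ := side C u2 l hlp xi2 f2 a2 b2 c2 J2 hJ2 x2 P2 _ (by positivity) ct2
  have hd := hdiff (x1 + (P1 + l • x1), x2 + (P2 + l • x2)) (by
    simp only [F, z1, z2]
    ext1
    · simp only [hP1]; module
    · simp only [hP2]; module)
  have hd1 : DifferentiableAt ℝ J1 (x1 + (P1 + l • x1)) := by
    have a : DifferentiableAt ℝ (fun z => (Jm z).1) (x1 + (P1 + l • x1), x2 + (P2 + l • x2)) := hd.fst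
    have b : DifferentiableAt ℝ (fun y : E => (y, x2 + (P2 + l • x2))) (x1 + (P1 + l • x1)) := by fun_prop
    exact DifferentiableAt.comp (g := fun z => (Jm z).1) (x1 + (P1 + l • x1)) a b
  have hd2 : DifferentiableAt ℝ J2 (x2 + (P2 + l • x2)) := by
    have a : DifferentiableAt ℝ (fun z => (Jm z).2) (x1 + (P1 + l • x1), x2 + (P2 + l • x2)) := hd.snd
    have b : DifferentiableAt ℝ (fun y : E => (x1 + (P1 + l • x1), y)) (x2 + (P2 + l • x2)) := by fun_prop
    exact DifferentiableAt.comp (g := fun z => (Jm z).2) (x2 + (P2 + l • x2)) a b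
  obtain ⟨B1, d1, e1, g1⟩ := w1 hd1
  obtain ⟨B2, d2, e2, g2⟩ := w2 hd2
  have nd : ‖x1 - x2‖ ≤ 4 * σ := (norm_sub_le _ _).trans (by linarith)
  have nP1 : ‖P1‖ ≤ (5 + 12 * n) * σ := by
    rw [hP1]
    refine (norm_add₃_le).trans ?_
    rw [norm_smul, norm_smul, Real.norm_of_nonneg hlp.le, Real.norm_of_nonneg (by positivity)]
    nlinarith
  have nP2 : ‖P2‖ ≤ (5 + 12 * n) * σ := by
    rw [hP2, sub_eq_add_neg]
    refine (norm_add₃_le).trans ?_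
    rw [norm_neg, norm_smul, norm_smul, Real.norm_of_nonneg hlp.le, Real.norm_of_nonneg (by positivity)]
    nlinarith
  have nx : ∀ (x P ξ : E), ‖x‖ ≤ 2 * σ → ‖P‖ ≤ (5 + 12 * n) * σ → l • ξ = P + l • x →
      ‖ξ‖ ≤ (2 + (5 + 12 * n) / (3 * n)) * σ := by
    intro x P ξ h1 h2 h3
    have h4 : l * ‖ξ‖ ≤ ‖P‖ + l * ‖x‖ := by
      have : ‖l • ξ‖ ≤ ‖P‖ + ‖l • x‖ := by rw [h3]; exact norm_add_le _ _
      simpa only [norm_smul, Real.norm_of_nonneg hlp.le] using this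
    have h5 : l * ‖ξ‖ ≤ l * ((2 + (5 + 12 * n) / l) * σ) := by
      have : l * ((2 + (5 + 12 * n) / l) * σ) = (5 + 12 * n) * σ + l * (2 * σ) := by
        field_simp; ring
      rw [this]; nlinarith
    exact le_of_mul_le_mul_left h5 hlp
  refine ⟨xi1 x1, a1 x1, xi2 x2, a2 x2, P1, P2, B1, B2, nx _ _ _ hx1 nP1 y1, nx _ _ _ hx2 nP2 y2,
    nP1, nP2, g1, g2, e1, e2, ?_⟩
  intro v w
  have : ⟪B1 v, v⟫ + ⟪B2 w, w⟫ - (l * ‖v - w‖ ^ 2 + 2 * σ * (‖v‖ ^ 2 + ‖w‖ ^ 2)) ≤ 0 := by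
    refine le_zero_of_eps (K := 2 * (‖v‖ ^ 2 + ‖w‖ ^ 2)) (by positivity) (fun ε hε => ?_)
    obtain ⟨δ1, hδ1, H1⟩ := d1 ε hε
    obtain ⟨δ2, hδ2, H2⟩ := d2 ε hε
    obtain ⟨t, ht, ht'⟩ := exists_small (E := E × E) (v, w) (min δ1 δ2) (lt_min hδ1 hδ2)
    have t1 : ‖t • v‖ < δ1 := ((norm_fst_le (t • (v, w))).trans_lt ht').trans_le (min_le_left _ _)
    have t2 : ‖t • w‖ < δ2 := ((norm_snd_le (t • (v, w))).trans_lt ht').trans_le (min_le_right _ _)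
    have r1 := (abs_le.1 (H1 _ t1)).1
    have r2 := (abs_le.1 (H2 _ t2)).1
    have r3 := contact (t • v) (t • w)
    rw [← smul_sub] at r3
    simp only [map_smul, inner_smul_left, inner_smul_right, norm_smul, mul_pow, Real.norm_eq_abs,
      sq_abs, conj_trivial] at r1 r2 r3
    have : t ^ 2 * (⟪B1 v, v⟫ + ⟪B2 w, w⟫ - (l * ‖v - w‖ ^ 2 + 2 * σ * (‖v‖ ^ 2 + ‖w‖ ^ 2)))
        ≤ t ^ 2 * (ε * (2 * (‖v‖ ^ 2 + ‖w‖ ^ 2))) := by linarith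
    exact le_of_mul_le_mul_left this (by positivity)
  linarith

end Abs2

lemma exists_symm_matrix {d : ℕ} (B : Euc d →L[ℝ] Euc d) :
    ∃ X : Matrix (Fin d) (Fin d) ℝ, X.IsSymm ∧ ∀ h, quadForm X h = ⟪B h, h⟫ := by
  let M : Matrix (Fin d) (Fin d) ℝ := fun i j => (B (EuclideanSpace.single j 1)) i
  refine ⟨(1 / 2 : ℝ) • (M + M.transpose), ?_, ?_⟩
  · rw [Matrix.IsSymm, Matrix.transpose_smul, Matrix.transpose_add, Matrix.transpose_transpose,
      add_comm]
  · intro h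
    have hB : ∀ i, (B h) i = ∑ j, M i j * h j := by
      intro i
      have e : h = ∑ j, h j • EuclideanSpace.single j (1 : ℝ) := by
        ext k
        simp [Pi.single_apply]
      conv_lhs => rw [e, map_sum]
      simp [M, mul_comm]
    have e1 : ⟪B h, h⟫ = ∑ i, ∑ j, M i j * h i * h j := by
      rw [PiLp.inner_apply]
      refine Finset.sum_congr rfl fun i _ => ?_
      rw [hB i]
      simp only [RCLike.inner_apply, conj_trivial]
      rw [Finset.mul_sum]
      exact Finset.sum_congr rfl fun j _ => by ring
    have e2 : ⟪B h, h⟫ = ∑ i, ∑ j, M j i * h i * h j := by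
      rw [e1, Finset.sum_comm]
      exact Finset.sum_congr rfl fun i _ => Finset.sum_congr rfl fun j _ => by ring
    have e3 : quadForm ((1 / 2 : ℝ) • (M + M.transpose)) h
        = 1 / 2 * (∑ i, ∑ j, M i j * h i * h j + ∑ i, ∑ j, M j i * h i * h j) := by
      unfold quadForm
      rw [← Finset.sum_add_distrib, Finset.mul_sum]
      refine Finset.sum_congr rfl fun i _ => ?_
      rw [← Finset.sum_add_distrib, Finset.mul_sum]
      refine Finset.sum_congr rfl fun j _ => ?_
      simp only [Matrix.smul_apply, Matrix.add_apply, Matrix.transpose_apply, smul_eq_mul]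
      ring
    rw [e3, ← e1, ← e2]
    ring

lemma entry_bound {d : ℕ} (X : Matrix (Fin d) (Fin d) ℝ) (hX : X.IsSymm) (K : ℝ)
    (hK : ∀ h, |quadForm X h| ≤ K * ‖h‖ ^ 2) (i j : Fin d) : |X i j| ≤ K := by
  set a : Euc d := EuclideanSpace.single i 1 with ha
  set b : Euc d := EuclideanSpace.single j 1 with hb
  have key : quadForm X (a + b) - quadForm X (a - b) = 4 * X i j := by
    have e : quadForm X (a + b) - quadForm X (a - b)
        = ∑ k, ∑ m, (2 * (X k m * a k * b m) + 2 * (X k m * b k * a m)) := by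
      unfold quadForm
      rw [← Finset.sum_sub_distrib]
      refine Finset.sum_congr rfl fun k _ => ?_
      rw [← Finset.sum_sub_distrib]
      refine Finset.sum_congr rfl fun m _ => ?_
      simp only [PiLp.add_apply, PiLp.sub_apply]
      ring
    rw [e]
    simp only [Finset.sum_add_distrib, ← Finset.mul_sum]
    have s1 : ∑ k, ∑ m, X k m * a k * b m = X i j := by
      simp [ha, hb, Pi.single_apply]
    have s2 : ∑ k, ∑ m, X k m * b k * a m = X j i := by
      simp [ha, hb, Pi.single_apply]
    rw [s1, s2, hX.apply i j]
    ring
  have na : ‖a‖ = 1 := by simp [ha]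
  have nb : ‖b‖ = 1 := by simp [hb]
  have p1 := hK (a + b)
  have p2 := hK (a - b)
  have par := parallelogram_law_with_norm ℝ a b
  rw [na, nb] at par
  have : |4 * X i j| ≤ 4 * K := by
    rw [← key]
    refine (abs_sub _ _).trans ?_
    have par2 : K * ‖a + b‖ ^ 2 + K * ‖a - b‖ ^ 2 = 4 * K := by
      rw [← mul_add, par]; ring
    linarith
  rw [abs_mul] at this
  norm_num at this
  linarith

lemma quadForm_neg {d : ℕ} (X : Matrix (Fin d) (Fin d) ℝ) (h : Euc d) :
    quadForm (-X) h = - quadForm X h := by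
  simp [quadForm]

/-- Ishii's lemma: if `Δ(x,y) = v(x) − ṽ(y) − (n/2)|x−y|²` attains a local
maximum on `𝒪 × 𝒪` at `(x̂,ŷ)`, then there are symmetric matrices `X, Y` with
`(n(x̂−ŷ), X) ∈ J̄⁺v(x̂)`, `(n(x̂−ŷ), Y) ∈ J̄⁻ṽ(ŷ)` and
`⟨Xu,u⟩ − ⟨Yw,w⟩ ≤ 3n|u−w|²` for all `u, w`. -/
theorem ishii_lemma
    {d : ℕ} (O : Set (Euc d)) (hO : IsOpen O)
    (v vt : Euc d → ℝ) (hv : ContinuousOn v O) (hvt : ContinuousOn vt O)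
    (n : ℝ) (hn : 0 < n)
    (xh yh : Euc d) (hxh : xh ∈ O) (hyh : yh ∈ O)
    (hmax : IsLocalMaxOn
      (fun q : Euc d × Euc d => v q.1 - vt q.2 - (n/2) * ‖q.1 - q.2‖ ^ 2)
      (O ×ˢ O) (xh, yh)) :
    ∃ X Y : Matrix (Fin d) (Fin d) ℝ, X.IsSymm ∧ Y.IsSymm ∧
      MemClosureSuperjet O v xh (n • (xh - yh)) X ∧
      MemClosureSubjet O vt yh (n • (xh - yh)) Y ∧
      ∀ u w : Euc d, quadForm X u - quadForm Y w ≤ 3 * n * ‖u - w‖ ^ 2 := by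
  -- a common radius
  obtain ⟨r, hr, hrO1, hrO2, hrmax⟩ : ∃ r > 0, (∀ ξ : Euc d, ‖ξ‖ ≤ r → xh + ξ ∈ O) ∧
      (∀ ξ : Euc d, ‖ξ‖ ≤ r → yh + ξ ∈ O) ∧
      ∀ ξ η : Euc d, ‖ξ‖ ≤ r → ‖η‖ ≤ r →
        v (xh + ξ) - vt (yh + η) - (n/2) * ‖(xh + ξ) - (yh + η)‖ ^ 2 ≤
          v xh - vt yh - (n/2) * ‖xh - yh‖ ^ 2 := by
    have hmem : O ×ˢ O ∈ 𝓝 (xh, yh) := (hO.prod hO).mem_nhds ⟨hxh, hyh⟩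
    have h1 : ∀ᶠ q in 𝓝 (xh, yh), (v q.1 - vt q.2 - (n/2) * ‖q.1 - q.2‖ ^ 2 ≤
          v xh - vt yh - (n/2) * ‖xh - yh‖ ^ 2) ∧ q ∈ O ×ˢ O := by
      have := hmax
      rw [IsLocalMaxOn, IsMaxFilter, nhdsWithin_eq_nhds.2 hmem] at this
      exact this.and hmem
    rw [Metric.eventually_nhds_iff] at h1
    obtain ⟨ε, hε, H⟩ := h1
    have H' : ∀ ξ η : Euc d, ‖ξ‖ ≤ ε / 2 → ‖η‖ ≤ ε / 2 → dist (xh + ξ, yh + η) (xh, yh) < ε := by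
      intro ξ η h1 h2
      rw [Prod.dist_eq]
      simp only [dist_self_add_left]
      exact max_lt (by linarith) (by linarith)
    refine ⟨ε / 2, by positivity, ?_, ?_, ?_⟩
    · intro ξ h
      exact (H (H' ξ 0 h (by simp; positivity))).2.1
    · intro ξ h
      exact (H (H' 0 ξ (by simp; positivity) h)).2.2
    · intro ξ η h1 h2
      exact (H (H' ξ η h1 h2)).1
  set ph := n • (xh - yh) with hph
  let C : Set (Euc d) := Metric.closedBall 0 r
  have memC : ∀ ξ, ξ ∈ C ↔ ‖ξ‖ ≤ r := fun ξ => mem_closedBall_zero_iff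
  let u1 : Euc d → ℝ := fun ξ => v (xh + ξ) - v xh - ⟪ph, ξ⟫
  let u2 : Euc d → ℝ := fun ξ => - vt (yh + ξ) + vt yh + ⟪ph, ξ⟫
  have hu1 : ContinuousOn u1 C := by
    have : ContinuousOn (fun ξ => v (xh + ξ)) C :=
      hv.comp (by fun_prop) (fun ξ h => hrO1 ξ ((memC ξ).1 h))
    exact (this.sub continuousOn_const).sub (by fun_prop)
  have hu2 : ContinuousOn u2 C := by
    have : ContinuousOn (fun ξ => vt (yh + ξ)) C :=
      hvt.comp (by fun_prop) (fun ξ h => hrO2 ξ ((memC ξ).1 h))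
    exact (this.neg.add continuousOn_const).add (by fun_prop)
  have hum : ∀ ξ ∈ C, ∀ η ∈ C, u1 ξ + u2 η ≤ n / 2 * ‖ξ - η‖ ^ 2 := by
    intro ξ h1 η h2
    have := hrmax ξ η ((memC ξ).1 h1) ((memC η).1 h2)
    have e : xh + ξ - (yh + η) = (xh - yh) + (ξ - η) := by abel
    rw [e, norm_add_sq_real] at this
    have e2 : ⟪ph, ξ⟫ - ⟪ph, η⟫ = n * ⟪xh - yh, ξ - η⟫ := by
      rw [← inner_sub_right, hph, inner_smul_left]; simp
    simp only [u1, u2]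
    linarith
  let σ : ℕ → ℝ := fun k => 1 / ((k : ℝ) + 1)
  have hσ0 : ∀ k, 0 < σ k := fun k => by simp only [σ]; positivity
  have hσ1 : ∀ k, σ k ≤ 1 := fun k => by
    simp only [σ]
    rw [div_le_one (by positivity)]
    linarith [(Nat.cast_nonneg k : (0:ℝ) ≤ k)]
  have hσt : Tendsto σ atTop (𝓝 0) := tendsto_one_div_add_atTop_nhds_zero_nat
  have step := fun k => main_step n hn C (isCompact_closedBall 0 r) ((memC 0).2 (by simp; positivity))
    u1 u2 hu1 hu2 (by simp [u1]) (by simp [u2]) hum (σ k) (hσ0 k) (hσ1 k)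
  choose ξ1 hξ1 ξ2 hξ2 P1 P2 B1 B2 nξ1 nξ2 nP1 nP2 J1 J2 L1 L2 U using step
  choose X hXs hXq using fun k => exists_symm_matrix (B1 k)
  choose Z hZs hZq using fun k => exists_symm_matrix (B2 k)
  -- limits of points and slopes
  have tend : ∀ (a : ℕ → Euc d) (K : ℝ), (∀ k, ‖a k‖ ≤ K * σ k) → Tendsto a atTop (𝓝 0) := by
    intro a K h
    exact squeeze_zero_norm h (by simpa using hσt.const_mul K)
  have tξ1 := tend ξ1 _ nξ1
  have tξ2 := tend ξ2 _ nξ2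
  have tP1 := tend P1 _ nP1
  have tP2 := tend P2 _ nP2
  -- bounds for the matrices
  have bX : ∀ k i j, |X k i j| ≤ 3 * n + 2 := by
    intro k
    refine entry_bound (X k) (hXs k) _ (fun h => ?_)
    have a := L1 k h
    have b := U k h 0
    simp only [sub_zero, map_zero, inner_zero_right, norm_zero] at b
    have c := mul_le_mul_of_nonneg_right (hσ1 k) (sq_nonneg ‖h‖)
    rw [hXq, abs_le]
    constructor <;> nlinarith [sq_nonneg ‖h‖]
  have bZ : ∀ k i j, |Z k i j| ≤ 3 * n + 2 := by
    intro k
    refine entry_bound (Z k) (hZs k) _ (fun h => ?_)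
    have a := L2 k h
    have b := U k 0 h
    simp only [zero_sub, norm_neg, map_zero, inner_zero_right, norm_zero] at b
    have c := mul_le_mul_of_nonneg_right (hσ1 k) (sq_nonneg ‖h‖)
    rw [hZq, abs_le]
    constructor <;> nlinarith [sq_nonneg ‖h‖]
  let S : Set (Matrix (Fin d) (Fin d) ℝ) :=
    Set.pi univ fun _ => Set.pi univ fun _ => Icc (-(3 * n + 2)) (3 * n + 2)
  have hS : IsCompact S := isCompact_univ_pi fun _ => isCompact_univ_pi fun _ => isCompact_Icc
  have : FirstCountableTopology (Matrix (Fin d) (Fin d) ℝ) :=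
    inferInstanceAs (FirstCountableTopology (Fin d → Fin d → ℝ))
  obtain ⟨⟨X0, Z0⟩, -, φ, hφ, hlim⟩ := (hS.prod hS).tendsto_subseq (x := fun k => (X k, Z k))
    (fun k => ⟨fun i _ j _ => abs_le.1 (bX k i j), fun i _ j _ => abs_le.1 (bZ k i j)⟩)
  have hX0 : Tendsto (fun k => X (φ k)) atTop (𝓝 X0) :=
    (continuous_fst.tendsto (X0, Z0)).comp hlim
  have hZ0 : Tendsto (fun k => Z (φ k)) atTop (𝓝 Z0) :=
    (continuous_snd.tendsto (X0, Z0)).comp hlim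
  have hφt := hφ.tendsto_atTop
  have qc : ∀ u : Euc d, Continuous (fun X : Matrix (Fin d) (Fin d) ℝ => quadForm X u) := by
    intro u
    unfold quadForm
    refine continuous_finsetSum _ fun i _ => continuous_finsetSum _ fun j _ => ?_
    exact ((continuous_id.matrix_elem i j).mul continuous_const).mul continuous_const
  -- eventually interior
  obtain ⟨N, hN⟩ : ∃ N, ∀ k ≥ N, ‖ξ1 (φ k)‖ < r ∧ ‖ξ2 (φ k)‖ < r := by
    have e1 : ∀ᶠ k in atTop, ξ1 (φ k) ∈ Metric.ball 0 r :=
      (tξ1.comp hφt).eventually (Metric.ball_mem_nhds 0 hr)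
    have e2 : ∀ᶠ k in atTop, ξ2 (φ k) ∈ Metric.ball 0 r :=
      (tξ2.comp hφt).eventually (Metric.ball_mem_nhds 0 hr)
    obtain ⟨N, h⟩ := eventually_atTop.1 (e1.and e2)
    exact ⟨N, fun k hk => by simpa using h k hk⟩
  have hψt : Tendsto (fun k => φ (k + N)) atTop atTop := hφt.comp (tendsto_add_atTop_nat N)
  have hX1 : Tendsto (fun k => X (φ (k + N))) atTop (𝓝 X0) := hX0.comp (tendsto_add_atTop_nat N)
  have hZ1 : Tendsto (fun k => Z (φ (k + N))) atTop (𝓝 Z0) := hZ0.comp (tendsto_add_atTop_nat N)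
  have tx : Tendsto (fun k => xh + ξ1 (φ (k + N))) atTop (𝓝 xh) := by
    simpa using (tξ1.comp hψt).const_add xh
  have ty : Tendsto (fun k => yh + ξ2 (φ (k + N))) atTop (𝓝 yh) := by
    simpa using (tξ2.comp hψt).const_add yh
  refine ⟨X0, -Z0, ?_, ?_, ?_, ?_, ?_⟩
  · refine tendsto_nhds_unique ((continuous_id.matrix_transpose.tendsto X0).comp hX0) ?_
    refine hX0.congr fun k => ?_
    exact (hXs (φ k)).symm
  · refine Matrix.IsSymm.neg ?_
    refine tendsto_nhds_unique ((continuous_id.matrix_transpose.tendsto Z0).comp hZ0) ?_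
    refine hZ0.congr fun k => ?_
    exact (hZs (φ k)).symm
  · refine ⟨fun k => xh + ξ1 (φ (k + N)), fun k => ph + P1 (φ (k + N)), fun k => X (φ (k + N)),
      fun k => ⟨hrO1 _ (hN (k + N) (by omega)).1.le, ?_⟩, tx, ?_, ?_, hX1⟩
    · intro ε hε
      obtain ⟨δ, hδ, H⟩ := J1 (φ (k + N)) ε hε
      have hrk := (hN (k + N) (by omega)).1
      refine ⟨min δ (r - ‖ξ1 (φ (k + N))‖), lt_min hδ (by linarith), fun h hh _ => ?_⟩
      have := H h (hh.trans_le (min_le_left _ _)) ((memC _).2 ((norm_add_le _ _).trans (by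
        have := hh.trans_le (min_le_right _ _); linarith)))
      simp only [u1, inner_add_right] at this
      rw [← hXq] at this
      simp only [Qpx, inner_add_left, add_assoc] at this ⊢
      linarith
    · exact ((hv.continuousAt (hO.mem_nhds hxh)).tendsto).comp tx
    · simpa using (tP1.comp hψt).const_add ph
  · refine ⟨fun k => yh + ξ2 (φ (k + N)), fun k => ph - P2 (φ (k + N)), fun k => - Z (φ (k + N)),
      fun k => ⟨hrO2 _ (hN (k + N) (by omega)).2.le, ?_⟩, ty, ?_, ?_, hZ1.neg⟩
    · intro ε hε
      obtain ⟨δ, hδ, H⟩ := J2 (φ (k + N)) ε hε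
      have hrk := (hN (k + N) (by omega)).2
      refine ⟨min δ (r - ‖ξ2 (φ (k + N))‖), lt_min hδ (by linarith), fun h hh _ => ?_⟩
      have := H h (hh.trans_le (min_le_left _ _)) ((memC _).2 ((norm_add_le _ _).trans (by
        have := hh.trans_le (min_le_right _ _); linarith)))
      simp only [u2, inner_add_right] at this
      rw [← hZq] at this
      simp only [Qpx, inner_sub_left, quadForm_neg, add_assoc] at this ⊢
      linarith
    · exact ((hvt.continuousAt (hO.mem_nhds hyh)).tendsto).comp ty
    · simpa using (tP2.comp hψt).const_sub ph
  · intro u w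
    rw [quadForm_neg, sub_neg_eq_add]
    have l1 := (((qc u).tendsto X0).comp hX0).add (((qc w).tendsto Z0).comp hZ0)
    have l2 : Tendsto (fun k => 3 * n * ‖u - w‖ ^ 2 + 2 * σ (φ k) * (‖u‖ ^ 2 + ‖w‖ ^ 2)) atTop
        (𝓝 (3 * n * ‖u - w‖ ^ 2 + 2 * 0 * (‖u‖ ^ 2 + ‖w‖ ^ 2))) :=
      (((hσt.comp hφt).const_mul 2).mul_const _).const_add _
    have := le_of_tendsto_of_tendsto' l1 l2 (fun k => by
      simp only [Function.comp, hXq, hZq]; exact U (φ k) u w)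
    simpa using this

end
end

section
/- Trace estimate from the Ishii matrix inequality: let a = Ξ Ξ^T for an m×d matrix Ξ, and for x ∈ ℝ^d let A(x) be the d×d matrix with entries A(x)^{ij} = a^{ij} x^i x^j. Let n > 0 and let X, Y be symmetric d×d matrices satisfying ⟨Xu, u⟩ − ⟨Yw, w⟩ ≤ 3n |u − w|² for all u, w ∈ ℝ^d. Then for all x, y ∈ ℝ^d, tr(A(x)X − A(y)Y) ≤ 3n · tr(a) · |x − y|². -/
open Set Filter Topology RealInnerProductSpace

noncomputable section

/-- The matrix `A(x)` with entries `A(x)^{ij} = a^{ij} x^i x^j`. -/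
def Amat {d : ℕ} (a : Matrix (Fin d) (Fin d) ℝ) (x : Euc d) : Matrix (Fin d) (Fin d) ℝ :=
  fun i j => a i j * x i * x j

theorem trace_Amat_eq {d m : ℕ} (Ξ : Matrix (Fin m) (Fin d) ℝ)
    (X : Matrix (Fin d) (Fin d) ℝ) (hX : X.IsSymm) (x : Euc d) :
    Matrix.trace (Amat (Matrix.transpose Ξ * Ξ) x * X) =
      ∑ k, quadForm X (WithLp.toLp 2 (fun i => Ξ k i * x i)) := by
  simp only [Matrix.trace, Matrix.diag, Matrix.mul_apply, Amat, quadForm, Matrix.transpose_apply,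
    Finset.sum_mul]
  symm
  rw [Finset.sum_comm]
  refine Finset.sum_congr rfl fun i _ => ?_
  rw [Finset.sum_comm]
  refine Finset.sum_congr rfl fun j _ => Finset.sum_congr rfl fun k _ => ?_
  rw [← hX.apply i j]
  ring

/-- Trace estimate from the Ishii matrix inequality: if
`⟨Xu,u⟩ − ⟨Yw,w⟩ ≤ 3n|u−w|²` for all `u, w`, then with `a = ΞᵀΞ` and `A(x)^{ij} = a^{ij}x^i x^j`,
`tr(A(x)X − A(y)Y) ≤ 3n · tr(a) · |x−y|²` for all `x, y`. -/
theorem ishii_trace_estimate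
    {d m : ℕ} (Ξ : Matrix (Fin m) (Fin d) ℝ)
    (n : ℝ) (hn : 0 < n)
    (X Y : Matrix (Fin d) (Fin d) ℝ) (hX : X.IsSymm) (hY : Y.IsSymm)
    (hXY : ∀ u w : Euc d, quadForm X u - quadForm Y w ≤ 3 * n * ‖u - w‖ ^ 2) :
    ∀ x y : Euc d,
      Matrix.trace (Amat (Matrix.transpose Ξ * Ξ) x * X - Amat (Matrix.transpose Ξ * Ξ) y * Y) ≤
        3 * n * Matrix.trace (Matrix.transpose Ξ * Ξ) * ‖x - y‖ ^ 2 := by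
  intro x y
  rw [Matrix.trace_sub, trace_Amat_eq Ξ X hX x, trace_Amat_eq Ξ Y hY y, ← Finset.sum_sub_distrib]
  have htr : Matrix.trace (Matrix.transpose Ξ * Ξ) = ∑ k, ∑ i, Ξ k i ^ 2 := by
    simp only [Matrix.trace, Matrix.diag, Matrix.mul_apply, Matrix.transpose_apply]
    rw [Finset.sum_comm]
    simp only [sq]
  rw [htr, Finset.mul_sum, Finset.sum_mul]
  refine Finset.sum_le_sum fun k _ => (hXY _ _).trans ?_
  rw [mul_assoc (3 * n)]
  refine mul_le_mul_of_nonneg_left ?_ (by positivity)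
  rw [EuclideanSpace.real_norm_sq_eq, Finset.sum_mul]
  refine Finset.sum_le_sum fun i _ => ?_
  have h1 : (x i - y i) ^ 2 ≤ ‖x - y‖ ^ 2 := by
    rw [EuclideanSpace.real_norm_sq_eq]
    exact Finset.single_le_sum (f := fun i => ((x - y) i) ^ 2)
      (fun j _ => sq_nonneg _) (Finset.mem_univ i)
  have h2 := mul_le_mul_of_nonneg_left h1 (sq_nonneg (Ξ k i))
  simp only [PiLp.sub_apply]
  calc _ = Ξ k i ^ 2 * (x i - y i) ^ 2 := by ring
    _ ≤ _ := h2

end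
end

section
/- Uniform lower bound on the Hamiltonian discrepancy: let 𝒞 ⊆ K be a closed cone and let U : 𝒞 → ℝ₊ be a continuous concave function with U(0) = 0 and U(c)/|c| → 0 as |c| → ∞, c ∈ 𝒞. Let P be a compact subset of ℝ^d and ε > 0 such that p·c ≥ ε|c| for every p ∈ P and c ∈ 𝒞. Then there exists κ ≥ 1 such that for all p ∈ P and all c ∈ 𝒞 with |c| ≥ κ, U*(p) + p·c − U(c) ≥ (ε/2)|c|, where U*(p) := sup_{c∈𝒞}(U(c) − p·c). -/
open Set Filter Topology RealInnerProductSpace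

noncomputable section

/-- `U*(p) = sup_{c ∈ 𝒞} (U(c) − p·c)`. -/
def Ustar {d : ℕ} (C : Set (Euc d)) (U : Euc d → ℝ) (p : Euc d) : ℝ :=
  sSup ((fun c => U c - ⟪p, c⟫) '' C)

/-- Uniform lower bound on the Hamiltonian discrepancy: for a closed convex
cone `𝒞 ⊆ K`, a continuous concave `U : 𝒞 → ℝ₊` with `U(0) = 0` and `U(c)/|c| → 0`, a compact
set `P` and `ε > 0` with `p·c ≥ ε|c|` on `P × 𝒞`, there is `κ ≥ 1` such that
`U*(p) + p·c − U(c) ≥ (ε/2)|c|` whenever `p ∈ P`, `c ∈ 𝒞`, `|c| ≥ κ`. -/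
theorem hamiltonian_discrepancy_lower_bound
    {d : ℕ} (K C : Set (Euc d))
    -- `K` is a proper closed convex cone with nonempty interior
    (hKclosed : IsClosed K) (hKconv : Convex ℝ K)
    (hKcone : ∀ c : ℝ, 0 ≤ c → ∀ x ∈ K, c • x ∈ K)
    (hKint : (interior K).Nonempty) (hKproper : K ∩ (-K) = {0})
    -- `𝒞 ⊆ K` is a closed cone
    (hCclosed : IsClosed C) (hCcone : ∀ c : ℝ, 0 ≤ c → ∀ x ∈ C, c • x ∈ C)
    (hCK : C ⊆ K)
    -- `U : 𝒞 → ℝ₊` continuous, concave, `U(0) = 0`, `U(c)/|c| → 0`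
    (U : Euc d → ℝ)
    (hUcont : ContinuousOn U C) (hUconc : ConcaveOn ℝ C U)
    (hUnonneg : ∀ c ∈ C, 0 ≤ U c) (hU0 : U 0 = 0)
    (hUsub : ∀ ε' > (0:ℝ), ∃ R : ℝ, ∀ c ∈ C, R ≤ ‖c‖ → U c ≤ ε' * ‖c‖)
    -- compact `P` and `ε > 0` with `p·c ≥ ε|c|` for `p ∈ P`, `c ∈ 𝒞`
    (P : Set (Euc d)) (hP : IsCompact P)
    (ε : ℝ) (hε : 0 < ε)
    (hPc : ∀ p ∈ P, ∀ c ∈ C, ε * ‖c‖ ≤ ⟪p, c⟫) :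
    ∃ κ : ℝ, 1 ≤ κ ∧ ∀ p ∈ P, ∀ c ∈ C, κ ≤ ‖c‖ →
      (ε / 2) * ‖c‖ ≤ Ustar C U p + ⟪p, c⟫ - U c := by
  obtain ⟨R, hR⟩ := hUsub (ε / 2) (half_pos hε)
  refine ⟨max 1 R, le_max_left _ _, ?_⟩
  intro p hp c hc hκ
  have h1 := hR c hc (le_trans (le_max_right _ _) hκ)
  have h2 := hPc p hp c hc
  have h0 : (0 : Euc d) ∈ C := by simpa using hCcone 0 le_rfl c hc
  have h3 : 0 ≤ Ustar C U p := by
    unfold Ustar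
    by_cases hb : BddAbove ((fun c => U c - ⟪p, c⟫) '' C)
    · exact le_csSup hb ⟨0, h0, by simp [hU0]⟩
    · rw [Real.sSup_of_not_bddAbove hb]
  linarith

end
end

section
/- Doubling-of-variables compactness lemma: let K ⊆ ℝ^d be closed, let W, W̃ : K → ℝ be continuous, and let ℓ : K → (0,∞) be continuous with ℓ(x) → ∞, |W(x)|/ℓ(x) → 0 and |W̃(x)|/ℓ(x) → 0 as |x| → ∞ in K. Suppose W(z) > W̃(z) for some z ∈ K and choose ε > 0 with W(z) − W̃(z) − 2εℓ(z) > 0. For n ≥ 0 define Δ_n(x,y) := W(x) − W̃(y) − (n/2)|x−y|² − ε[ℓ(x) + ℓ(y)] on K × K. Then: (i) for each n ≥ 0 the supremum Δ̄_n := sup_{K×K} Δ_n is attained at some (x_n, y_n), and all maximizers lie in the compact set {Δ₀ ≥ 0}, which is independent of n; (ii) Δ̄_n ≥ Δ̄ := sup_{x∈K} Δ₀(x,x) > 0 for all n; (iii) there exist a subsequence of maximizers (x_{n_k}, y_{n_k}) and a point x̂ ∈ K such that x_{n_k} → x̂, y_{n_k} → x̂, n_k |x_{n_k} − y_{n_k}|²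 → 0, and Δ̄_{n_k} → Δ₀(x̂, x̂) = Δ̄. -/
open Set Filter Topology

noncomputable section

/-- The doubled-variables penalized function
`Δ_n(x,y) = W(x) − W̃(y) − (n/2)|x−y|² − ε[ℓ(x) + ℓ(y)]`. -/
def doubling {d : ℕ} (W Wt ℓ : Euc d → ℝ) (ε : ℝ) (n : ℕ) (q : Euc d × Euc d) : ℝ :=
  W q.1 - Wt q.2 - ((n : ℝ) / 2) * ‖q.1 - q.2‖ ^ 2 - ε * (ℓ q.1 + ℓ q.2)

theorem doubling_aux {d : ℕ} (K : Set (Euc d)) (hK : IsClosed K) (f ℓ : Euc d → ℝ)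
    (hf : ContinuousOn f K) (hℓ : ContinuousOn ℓ K)
    (hℓinf : ∀ M : ℝ, ∃ R : ℝ, ∀ x ∈ K, R ≤ ‖x‖ → M ≤ ℓ x)
    (hgrow : ∀ ε' > (0:ℝ), ∃ R : ℝ, ∀ x ∈ K, R ≤ ‖x‖ → |f x| ≤ ε' * ℓ x)
    (ε : ℝ) (hε : 0 < ε) :
    (∀ M : ℝ, ∃ R : ℝ, ∀ x ∈ K, M ≤ f x - ε * ℓ x → ‖x‖ ≤ R) ∧
    ∃ C : ℝ, ∀ x ∈ K, f x - ε * ℓ x ≤ C := by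
  have h1 : ∀ M : ℝ, ∃ R : ℝ, ∀ x ∈ K, M ≤ f x - ε * ℓ x → ‖x‖ ≤ R := by
    intro M
    obtain ⟨R1, h1⟩ := hgrow (ε / 2) (by positivity)
    obtain ⟨R2, h2⟩ := hℓinf ((1 - M) / (ε / 2))
    refine ⟨max R1 R2, fun x hx hM => ?_⟩
    by_contra hlt
    push Not at hlt
    have a := h1 x hx ((le_max_left _ _).trans hlt.le)
    have b := h2 x hx ((le_max_right _ _).trans hlt.le)
    rw [div_le_iff₀ (by positivity)] at b
    have := le_abs_self (f x)
    linarith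
  refine ⟨h1, ?_⟩
  obtain ⟨R, hR⟩ := h1 0
  have hc : IsCompact (K ∩ Metric.closedBall 0 R) := (isCompact_closedBall _ _).inter_left hK
  have hcont : ContinuousOn (fun x => f x - ε * ℓ x) (K ∩ Metric.closedBall 0 R) :=
    (hf.sub (continuousOn_const.mul hℓ)).mono inter_subset_left
  obtain ⟨C, hC⟩ := hc.bddAbove_image hcont
  refine ⟨max C 0, fun x hx => ?_⟩
  by_cases h : 0 ≤ f x - ε * ℓ x
  · exact (hC ⟨x, ⟨hx, by simpa using hR x hx h⟩, rfl⟩).trans (le_max_left _ _)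
  · exact (not_le.1 h).le.trans (le_max_right _ _)

/-- Doubling-of-variables compactness lemma. -/
theorem doubling_of_variables_compactness
    {d : ℕ} (K : Set (Euc d)) (hKclosed : IsClosed K)
    (W Wt ℓ : Euc d → ℝ)
    (hW : ContinuousOn W K) (hWt : ContinuousOn Wt K) (hℓ : ContinuousOn ℓ K)
    (hℓpos : ∀ x ∈ K, 0 < ℓ x)
    (hℓinf : ∀ M : ℝ, ∃ R : ℝ, ∀ x ∈ K, R ≤ ‖x‖ → M ≤ ℓ x)
    (hWgrow : ∀ ε' > (0:ℝ), ∃ R : ℝ, ∀ x ∈ K, R ≤ ‖x‖ → |W x| ≤ ε' * ℓ x)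
    (hWtgrow : ∀ ε' > (0:ℝ), ∃ R : ℝ, ∀ x ∈ K, R ≤ ‖x‖ → |Wt x| ≤ ε' * ℓ x)
    (z : Euc d) (hz : z ∈ K) (hzgt : Wt z < W z)
    (ε : ℝ) (hε : 0 < ε) (hεz : 0 < W z - Wt z - 2 * ε * ℓ z) :
    -- (i) maximizers exist and all of them lie in the compact set `{Δ₀ ≥ 0}`
    ∃ q : ℕ → Euc d × Euc d,
      (∀ n : ℕ, q n ∈ K ×ˢ K ∧ IsMaxOn (doubling W Wt ℓ ε n) (K ×ˢ K) (q n)) ∧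
      IsCompact {q' ∈ K ×ˢ K | 0 ≤ doubling W Wt ℓ ε 0 q'} ∧
      (∀ n : ℕ, ∀ q' ∈ K ×ˢ K, IsMaxOn (doubling W Wt ℓ ε n) (K ×ˢ K) q' →
        0 ≤ doubling W Wt ℓ ε 0 q') ∧
      -- (ii) `Δ̄_n ≥ Δ̄ > 0`
      0 < sSup ((fun x => doubling W Wt ℓ ε 0 (x, x)) '' K) ∧
      (∀ n : ℕ, sSup ((fun x => doubling W Wt ℓ ε 0 (x, x)) '' K) ≤
        doubling W Wt ℓ ε n (q n)) ∧
      -- (iii) a subsequence of maximizers converging to a diagonal point `x̂`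
      ∃ φ : ℕ → ℕ, StrictMono φ ∧ ∃ xh ∈ K,
        Tendsto (fun k => (q (φ k)).1) atTop (𝓝 xh) ∧
        Tendsto (fun k => (q (φ k)).2) atTop (𝓝 xh) ∧
        Tendsto (fun k => (φ k : ℝ) * ‖(q (φ k)).1 - (q (φ k)).2‖ ^ 2) atTop (𝓝 0) ∧
        Tendsto (fun k => doubling W Wt ℓ ε (φ k) (q (φ k))) atTop
          (𝓝 (doubling W Wt ℓ ε 0 (xh, xh))) ∧
        doubling W Wt ℓ ε 0 (xh, xh) = sSup ((fun x => doubling W Wt ℓ ε 0 (x, x)) '' K) := by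
  set D := doubling W Wt ℓ ε with hD
  have hDe : ∀ n q, D n q = D 0 q - ((n : ℝ) / 2) * ‖q.1 - q.2‖ ^ 2 := by
    intro n q
    simp only [hD, doubling]
    push_cast
    ring
  have hDle : ∀ n q, D n q ≤ D 0 q := by
    intro n q
    rw [hDe n q]
    have : 0 ≤ ((n : ℝ) / 2) * ‖q.1 - q.2‖ ^ 2 := by positivity
    linarith
  have hDdiag : ∀ n x, D n (x, x) = D 0 (x, x) := by
    intro n x
    rw [hDe n]
    simp
  have hzpos : 0 < D 0 (z, z) := by
    simp only [hD, doubling]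
    simp
    linarith
  have hfst : MapsTo (Prod.fst : Euc d × Euc d → Euc d) (K ×ˢ K) K := fun q hq => hq.1
  have hsnd : MapsTo (Prod.snd : Euc d × Euc d → Euc d) (K ×ˢ K) K := fun q hq => hq.2
  have hcont : ∀ n, ContinuousOn (D n) (K ×ˢ K) := by
    intro n
    have c1 := hW.comp continuousOn_fst hfst
    have c2 := hWt.comp continuousOn_snd hsnd
    have c3 := hℓ.comp continuousOn_fst hfst
    have c4 := hℓ.comp continuousOn_snd hsnd
    have c5 : ContinuousOn (fun q : Euc d × Euc d => ((n : ℝ) / 2) * ‖q.1 - q.2‖ ^ 2)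
      (K ×ˢ K) := by fun_prop
    exact ((c1.sub c2).sub c5).sub (continuousOn_const.mul (c3.add c4))
  have hKK : IsClosed (K ×ˢ K) := hKclosed.prod hKclosed
  have hA : IsCompact {q' ∈ K ×ˢ K | 0 ≤ D 0 q'} := by
    obtain ⟨hg, Cg, hCg⟩ := doubling_aux K hKclosed W ℓ hW hℓ hℓinf hWgrow ε hε
    obtain ⟨hh, Ch, hCh⟩ := doubling_aux K hKclosed (fun x => - Wt x) ℓ hWt.neg hℓ hℓinf
      (by simpa using hWtgrow) ε hε
    obtain ⟨R1, hR1⟩ := hg (-Ch)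
    obtain ⟨R2, hR2⟩ := hh (-Cg)
    have hcl : IsClosed {q' ∈ K ×ˢ K | 0 ≤ D 0 q'} :=
      (hcont 0).preimage_isClosed_of_isClosed hKK isClosed_Ici
    refine ((isCompact_closedBall (0 : Euc d) R1).prod
      (isCompact_closedBall (0 : Euc d) R2)).of_isClosed_subset hcl ?_
    rintro ⟨x, y⟩ ⟨⟨hx, hy⟩, h⟩
    have a := hCg x hx
    have b := hCh y hy
    have e : D 0 (x, y) = (W x - ε * ℓ x) + (- Wt y - ε * ℓ y) := by
      simp only [hD, doubling]
      push_cast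
      ring
    rw [e] at h
    refine ⟨?_, ?_⟩
    · simpa using hR1 x hx (by linarith)
    · simpa using hR2 y hy (by linarith)
  have hzz : (z, z) ∈ K ×ˢ K := ⟨hz, hz⟩
  have hmax : ∀ n, ∃ q, q ∈ K ×ˢ K ∧ IsMaxOn (D n) (K ×ˢ K) q := by
    intro n
    obtain ⟨q, hq, hqm⟩ := hA.exists_isMaxOn ⟨(z, z), hzz, hzpos.le⟩
      ((hcont n).mono (fun q hq => hq.1))
    refine ⟨q, hq.1, fun p hp => ?_⟩
    by_cases h : 0 ≤ D 0 p
    · exact hqm ⟨hp, h⟩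
    · have h1 : D n (z, z) ≤ D n q := hqm ⟨hzz, hzpos.le⟩
      rw [hDdiag] at h1
      have := hDle n p
      show D n p ≤ D n q
      linarith
  choose q hqK hqm using hmax
  have hdiagle : ∀ n, ∀ x ∈ K, D 0 (x, x) ≤ D n (q n) := by
    intro n x hx
    rw [← hDdiag n]
    exact hqm n (show (x, x) ∈ K ×ˢ K from ⟨hx, hx⟩)
  have hbdd : BddAbove ((fun x => D 0 (x, x)) '' K) := by
    refine ⟨D 0 (q 0), ?_⟩
    rintro _ ⟨x, hx, rfl⟩
    exact hdiagle 0 x hx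
  have hii : ∀ n, sSup ((fun x => D 0 (x, x)) '' K) ≤ D n (q n) := by
    intro n
    refine csSup_le ⟨_, z, hz, rfl⟩ ?_
    rintro _ ⟨x, hx, rfl⟩
    exact hdiagle n x hx
  have hpos : 0 < sSup ((fun x => D 0 (x, x)) '' K) :=
    hzpos.trans_le (le_csSup hbdd ⟨z, hz, rfl⟩)
  refine ⟨q, fun n => ⟨hqK n, hqm n⟩, hA, ?_, hpos, hii, ?_⟩
  · intro n p hp hpm
    have h1 : D n (z, z) ≤ D n p := hpm hzz
    rw [hDdiag] at h1
    have := hDle n p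
    linarith
  obtain ⟨⟨a, b⟩, hab, φ, hφ, hlim⟩ := hA.tendsto_subseq (x := q)
    (fun n => ⟨hqK n, (hpos.le.trans (hii n)).trans (hDle n _)⟩)
  have l1 : Tendsto (fun k => (q (φ k)).1) atTop (𝓝 a) :=
    (continuous_fst.tendsto (a, b)).comp hlim
  have l2 : Tendsto (fun k => (q (φ k)).2) atTop (𝓝 b) :=
    (continuous_snd.tendsto (a, b)).comp hlim
  have l3 : Tendsto (fun k => ‖(q (φ k)).1 - (q (φ k)).2‖ ^ 2) atTop (𝓝 (‖a - b‖ ^ 2)) :=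
    (l1.sub l2).norm.pow 2
  have hφt : Tendsto (fun k => (φ k : ℝ)) atTop atTop :=
    tendsto_natCast_atTop_atTop.comp hφ.tendsto_atTop
  have l4 : Tendsto (fun k => ‖(q (φ k)).1 - (q (φ k)).2‖ ^ 2) atTop (𝓝 0) := by
    refine tendsto_of_tendsto_of_tendsto_of_le_of_le' tendsto_const_nhds
      (hφt.const_div_atTop (2 * D 0 (q 0))) (Eventually.of_forall fun k => by positivity) ?_
    filter_upwards [hφt.eventually_gt_atTop 0] with k hk
    rw [le_div_iff₀ hk]
    have h1 := hDe (φ k) (q (φ k))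
    have h2 := hpos.le.trans (hii (φ k))
    have h3 : D 0 (q (φ k)) ≤ D 0 (q 0) := hqm 0 (hqK _)
    nlinarith
  have hEq : a = b := by
    have := tendsto_nhds_unique l3 l4
    simpa [sub_eq_zero] using this
  subst hEq
  have l5 : Tendsto (fun k => D 0 (q (φ k))) atTop (𝓝 (D 0 (a, a))) := by
    refine ((hcont 0) (a, a) hab.1).tendsto.comp ?_
    exact tendsto_nhdsWithin_iff.2 ⟨hlim, Eventually.of_forall fun k => hqK _⟩
  have hval : D 0 (a, a) = sSup ((fun x => D 0 (x, x)) '' K) := by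
    refine le_antisymm (le_csSup hbdd ⟨a, hab.1.1, rfl⟩) ?_
    exact ge_of_tendsto l5 (Eventually.of_forall fun k => (hii (φ k)).trans (hDle _ _))
  have l6 : Tendsto (fun k => D (φ k) (q (φ k))) atTop (𝓝 (D 0 (a, a))) :=
    tendsto_of_tendsto_of_tendsto_of_le_of_le tendsto_const_nhds l5
      (fun k => hval.le.trans (hii (φ k))) (fun k => hDle _ _)
  refine ⟨φ, hφ, a, hab.1.1, l1, l2, ?_, l6, hval⟩
  have l7 := (l5.sub l6).const_mul 2
  rw [sub_self, mul_zero] at l7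
  refine l7.congr fun k => ?_
  rw [hDe (φ k)]
  ring

end
end
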